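/- Let φ : ℝ × ℝ → ℝ be smooth with φ_x nowhere zero, satisfying the KdV singularity manifold equation φ_t = φ_x {φ; x} at every point, where {φ; x} = (φ_xx/φ_x)_x − (1/2)(φ_xx/φ_x)². Then the function s := φ_x satisfies the interacting soliton KdV equation s² s_t = s² s_xxx − 3 s s_x s_xx + (3/2) s_x³ at every point. -/

import Mathlib

/-- Partial derivative with respect to the first (space) variable. -/
noncomputable def px (f : ℝ × ℝ → ℝ) : ℝ × ℝ → ℝ :=
  fun p => deriv (fun x => f (x, p.2)) p.1

/-- Partial derivative with respect to the second (time) variable. -/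
noncomputable def pt (f : ℝ × ℝ → ℝ) : ℝ × ℝ → ℝ :=
  fun p => deriv (fun t => f (p.1, t)) p.2

/-- Schwarzian derivative of `f` with respect to the space variable:
`{f; x} = (f_xx / f_x)_x - (1/2) (f_xx / f_x)²`. -/
noncomputable def schwarz (f : ℝ × ℝ → ℝ) : ℝ × ℝ → ℝ :=
  fun p => px (fun q => px (px f) q / px f q) p - (1/2) * (px (px f) p / px f p) ^ 2


theorem hasDerivAt_fst_fderiv {f : ℝ × ℝ → ℝ} {p : ℝ × ℝ} (hf : DifferentiableAt ℝ f p) :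
    HasDerivAt (fun x => f (x, p.2)) (fderiv ℝ f p (1, 0)) p.1 :=
  HasFDerivAt.comp_hasDerivAt (f := fun x : ℝ => (x, p.2)) p.1 hf.hasFDerivAt
    ((hasDerivAt_id p.1).prodMk (hasDerivAt_const p.1 p.2))

theorem hasDerivAt_snd_fderiv {f : ℝ × ℝ → ℝ} {p : ℝ × ℝ} (hf : DifferentiableAt ℝ f p) :
    HasDerivAt (fun t => f (p.1, t)) (fderiv ℝ f p (0, 1)) p.2 :=
  HasFDerivAt.comp_hasDerivAt (f := fun t : ℝ => (p.1, t)) p.2 hf.hasFDerivAt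
    ((hasDerivAt_const p.2 p.1).prodMk (hasDerivAt_id p.2))

theorem px_eq_fderiv {f : ℝ × ℝ → ℝ} (hf : Differentiable ℝ f) :
    px f = fun p => fderiv ℝ f p (1, 0) :=
  funext fun p => (hasDerivAt_fst_fderiv (hf p)).deriv

theorem pt_eq_fderiv {f : ℝ × ℝ → ℝ} (hf : Differentiable ℝ f) :
    pt f = fun p => fderiv ℝ f p (0, 1) :=
  funext fun p => (hasDerivAt_snd_fderiv (hf p)).deriv

theorem hasDerivAt_px {f : ℝ × ℝ → ℝ} (hf : Differentiable ℝ f) (p : ℝ × ℝ) :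
    HasDerivAt (fun x => f (x, p.2)) (px f p) p.1 :=
  (hasDerivAt_fst_fderiv (hf p)).differentiableAt.hasDerivAt

theorem ContDiff.px {f : ℝ × ℝ → ℝ} (hf : ContDiff ℝ (⊤ : ℕ∞) f) :
    ContDiff ℝ (⊤ : ℕ∞) (px f) := by
  rw [px_eq_fderiv (hf.differentiable (by simp))]
  exact (hf.fderiv_right (by simp)).clm_apply contDiff_const

theorem pt_px_comm {f : ℝ × ℝ → ℝ} (hf : ContDiff ℝ 2 f) : pt (px f) = px (pt f) := by
  have hd : Differentiable ℝ f := hf.differentiable (by simp)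
  have hd' : Differentiable ℝ (fderiv ℝ f) :=
    (hf.fderiv_right (m := 1) (by norm_num)).differentiable (by simp)
  have hv (v : ℝ × ℝ) : Differentiable ℝ fun p => fderiv ℝ f p v :=
    hd'.clm_apply (differentiable_const v)
  have key (p v w : ℝ × ℝ) :
      fderiv ℝ (fun q => fderiv ℝ f q v) p w = fderiv ℝ (fderiv ℝ f) p w v := by
    rw [fderiv_clm_apply (hd' p) (differentiableAt_const v)]
    simp
  rw [px_eq_fderiv hd, pt_eq_fderiv hd, px_eq_fderiv (hv _), pt_eq_fderiv (hv _)]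
  funext p
  rw [key, key]
  exact (hf.contDiffAt.isSymmSndFDerivAt (by simp)).eq _ _

/-- The right-hand side of the KdV singularity manifold equation, written in terms of `f_x`. -/
theorem px_mul_schwarz {f : ℝ × ℝ → ℝ} (hf : ContDiff ℝ (⊤ : ℕ∞) f) {p : ℝ × ℝ}
    (hp : px f p ≠ 0) :
    px f p * schwarz f p = px (px (px f)) p - (3 / 2) * (px (px f) p ^ 2 / px f p) := by
  have h1 := hasDerivAt_px (hf.px.differentiable (by simp)) p
  have h2 := hasDerivAt_px (hf.px.px.differentiable (by simp)) p
  have h : px (fun q => px (px f) q / px f q) p = _ := (h2.div h1 hp).deriv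
  rw [schwarz, h]
  field_simp
  ring

/-- If `φ` solves the KdV singularity manifold equation with `φ_x` nowhere zero, then
`s := φ_x` solves the interacting soliton KdV equation
`s² s_t = s² s_xxx - 3 s s_x s_xx + (3/2) s_x³`. -/
theorem kdvSing_to_intSolKdV
    (φ : ℝ × ℝ → ℝ) (hφ : ContDiff ℝ (⊤ : ℕ∞) φ) (hφx : ∀ p, px φ p ≠ 0)
    (hsing : ∀ p, pt φ p = px φ p * schwarz φ p) :
    ∀ p, (px φ p) ^ 2 * pt (px φ) p =
      (px φ p) ^ 2 * px (px (px (px φ))) p -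
        3 * px φ p * px (px φ) p * px (px (px φ)) p +
        (3/2) * (px (px φ) p) ^ 3 := by
  intro p
  have hs := hφ.px
  have h1 := hasDerivAt_px (hs.differentiable (by simp)) p
  have h2 := hasDerivAt_px (hs.px.differentiable (by simp)) p
  have h3 := hasDerivAt_px (hs.px.px.differentiable (by simp)) p
  have heq : pt φ = fun q => px (px (px φ)) q - (3 / 2) * (px (px φ) q ^ 2 / px φ q) :=
    funext fun q => (hsing q).trans (px_mul_schwarz hφ (hφx q))
  have h : px (fun q => px (px (px φ)) q - (3 / 2) * (px (px φ) q ^ 2 / px φ q)) p = _ :=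
    (h3.sub (((h2.pow 2).div h1 (hφx p)).const_mul (3 / 2))).deriv
  have hp := hφx p
  rw [pt_px_comm (contDiff_infty.1 hφ 2), heq, h]
  simp only [Prod.mk.eta, Pi.pow_apply]
  field_simp
  ring
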